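/- (Uniform expected mean-payoff value in an end-component) Let M = (Q, E, δ) be an MDP with weight function w : Q × Q → ℤ such that the whole state space Q is an end-component of M. Then the expected mean-payoff value is the same at every state: for all q, q' ∈ Q, ValMP(w)(q) = ValMP(w)(q'). -/

import Mathlib

open MeasureTheory Filter
open scoped Classical ENNReal

namespace MPP

/-- A Markov decision process: states `Q`, player-1 states `Q1` (the rest are
probabilistic), edge relation `E` with every state having a successor, and a
probabilistic transition function `δ` whose support at every probabilistic state
is exactly the set of successors. -/
structure MDP (Q : Type) where
  Q1 : Set Q
  E : Q → Q → Prop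
  E_nonempty : ∀ q, ∃ q', E q q'
  δ : Q → PMF Q
  δ_support : ∀ q, q ∉ Q1 → ∀ q', q' ∈ (δ q).support ↔ E q q'

/-- A strategy: given the history `h` (the states strictly before the current one)
and the current state `q`, if `q` is a player-1 state it selects a distribution on
successors of `q`. -/
structure Strategy {Q : Type} (M : MDP Q) where
  act : List Q → Q → PMF Q
  act_support : ∀ h q, q ∈ M.Q1 → ∀ q', q' ∈ (act h q).support → M.E q q'

variable {Q : Type}

/-- One step of the history-dependent transition kernel. -/
noncomputable def MDP.step (M : MDP Q) (σ : Strategy M) (h : List Q) (q : Q) : PMF Q :=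
  if q ∈ M.Q1 then σ.act h q else M.δ q

/-- Probability of traversing the finite sequence `future` starting at `q` with
past history `h`. -/
noncomputable def pathProb (M : MDP Q) (σ : Strategy M) : List Q → Q → List Q → ℝ≥0∞
  | _, _, [] => 1
  | h, q, q' :: rest => M.step σ h q q' * pathProb M σ (h ++ [q]) q' rest

/-- `μ` is the trajectory measure (Ionescu–Tulcea) on plays of `M` under strategy
`σ`, starting at `q`: it is the (unique) probability measure on `ℕ → Q` (product
σ-algebra) giving every cylinder its product probability. -/
def IsTrajMeasure [MeasurableSpace Q] (M : MDP Q) (σ : Strategy M) (q : Q)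
    (μ : Measure (ℕ → Q)) : Prop :=
  IsProbabilityMeasure μ ∧
    ∀ (n : ℕ) (f : ℕ → Q),
      μ {ρ | ∀ i ≤ n, ρ i = f i} =
        if f 0 = q then pathProb M σ [] q ((List.range n).map fun i => f (i + 1)) else 0

/-- The set of states occurring infinitely often in a play. -/
def infSet (ρ : ℕ → Q) : Set Q := {s | ∀ N, ∃ n, N ≤ n ∧ ρ n = s}

/-- End-component: nonempty, closed under probabilistic transitions, every state has
a successor inside, and strongly connected inside. -/
def MDP.IsEndComponent (M : MDP Q) (U : Set Q) : Prop :=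
  U.Nonempty ∧
    (∀ q ∈ U, q ∉ M.Q1 → (M.δ q).support ⊆ U) ∧
    (∀ q ∈ U, ∃ q' ∈ U, M.E q q') ∧
    ∀ q ∈ U, ∀ q' ∈ U, Relation.ReflTransGen (fun a b => a ∈ U ∧ b ∈ U ∧ M.E a b) q q'

/-- Energy level of the length-`n` prefix of a play. -/
def EL (w : Q → Q → ℤ) (ρ : ℕ → Q) (n : ℕ) : ℤ :=
  ∑ i ∈ Finset.range n, w (ρ i) (ρ (i + 1))

/-- Mean payoff (liminf of averages) of a play. -/
noncomputable def MP (w : Q → Q → ℤ) (ρ : ℕ → Q) : ℝ :=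
  liminf (fun n => (EL w ρ n : ℝ) / n) atTop

/-- Parity objective: the minimal priority visited infinitely often is even. -/
def ParitySet (p : Q → ℕ) : Set (ℕ → Q) := {ρ | Even (sInf (p '' infSet ρ))}

def MeanPayoffGe (w : Q → Q → ℤ) (ν : ℝ) : Set (ℕ → Q) := {ρ | ν ≤ MP w ρ}

def MeanPayoffGt (w : Q → Q → ℤ) (ν : ℝ) : Set (ℕ → Q) := {ρ | ν < MP w ρ}

/-- Energy objective with initial credit `c₀`. -/
def PosEnergy (w : Q → Q → ℤ) (c₀ : ℕ) : Set (ℕ → Q) :=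
  {ρ | ∀ n, 0 ≤ (c₀ : ℤ) + EL w ρ n}

/-- Büchi objective: some state of `B` is visited infinitely often. -/
def Buchi (B : Set Q) : Set (ℕ → Q) := {ρ | (infSet ρ ∩ B).Nonempty}

/-- Expected mean-payoff value: supremum over strategies of the expectation of the
mean payoff under the trajectory measure. -/
noncomputable def ValMP [MeasurableSpace Q] (M : MDP Q) (w : Q → Q → ℤ) (q : Q) : ℝ :=
  sSup {x | ∃ σ : Strategy M, ∃ μ : Measure (ℕ → Q),
    IsTrajMeasure M σ q μ ∧ x = ∫ ρ, MP w ρ ∂μ}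


/-- Two bounded real sequences with difference tending to zero have the same liminf. -/
lemma liminf_eq_of_tendsto_sub (u v : ℕ → ℝ) (W : ℝ) (hu : ∀ n, |u n| ≤ W)
    (hv : ∀ n, |v n| ≤ W) (h : Tendsto (fun n => u n - v n) atTop (nhds 0)) :
    liminf u atTop = liminf v atTop := by
  have key : ∀ u v : ℕ → ℝ, (∀ n, |u n| ≤ W) → (∀ n, |v n| ≤ W) →
      Tendsto (fun n => u n - v n) atTop (nhds 0) → liminf v atTop ≤ liminf u atTop := by
    intro u v hu hv h
    have e : u = v + fun n => u n - v n := by ext n; simp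
    have hz := h.liminf_eq
    have h1 := le_liminf_add (f := atTop) (u := v) (v := fun n => u n - v n)
      (isBoundedUnder_of ⟨-W, fun n => (abs_le.1 (hv n)).1⟩)
      (isBoundedUnder_of ⟨W, fun n => (abs_le.1 (hv n)).2⟩)
      h.isBoundedUnder_ge h.isBoundedUnder_le.isCoboundedUnder_ge
    rw [← e, hz, add_zero] at h1
    exact h1
  refine le_antisymm ?_ (key u v hu hv h)
  refine key v u hv hu ?_
  have := h.neg
  simpa using this

/-- Prepend a state to a play. -/
def consPlay (s : Q) (ρ : ℕ → Q) : ℕ → Q := fun n => Nat.casesOn n s ρ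

lemma abs_EL_div_le (w : Q → Q → ℤ) (W : ℝ) (hW : ∀ a b, |(w a b : ℝ)| ≤ W) (ρ : ℕ → Q) (n : ℕ) :
    |(EL w ρ n : ℝ) / n| ≤ W := by
  have hW0 : 0 ≤ W := (abs_nonneg _).trans (hW (ρ 0) (ρ 0))
  rcases Nat.eq_zero_or_pos n with rfl | hn
  · simpa using hW0
  have hn' : (0 : ℝ) < n := by exact_mod_cast hn
  rw [abs_div, abs_of_pos hn', div_le_iff₀ hn']
  unfold EL
  push_cast
  refine (Finset.abs_sum_le_sum_abs _ _).trans ?_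
  refine (Finset.sum_le_sum fun i _ => hW _ _).trans ?_
  simp [mul_comm]

lemma abs_MP_le (w : Q → Q → ℤ) (W : ℝ) (hW : ∀ a b, |(w a b : ℝ)| ≤ W) (ρ : ℕ → Q) :
    |MP w ρ| ≤ W := by
  have hb := abs_EL_div_le w W hW ρ
  have b1 : IsBoundedUnder (· ≥ ·) atTop (fun n => (EL w ρ n : ℝ) / n) :=
    isBoundedUnder_of ⟨-W, fun n => (abs_le.1 (hb n)).1⟩
  have b2 : IsBoundedUnder (· ≤ ·) atTop (fun n => (EL w ρ n : ℝ) / n) :=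
    isBoundedUnder_of ⟨W, fun n => (abs_le.1 (hb n)).2⟩
  rw [abs_le]
  constructor
  · exact le_liminf_of_le b2.isCoboundedUnder_ge
      (Eventually.of_forall fun n => (abs_le.1 (hb n)).1)
  · exact liminf_le_of_le b1 fun b h => by
      obtain ⟨n, hn⟩ := h.exists
      exact hn.trans (abs_le.1 (hb n)).2

lemma MP_consPlay (w : Q → Q → ℤ) (W : ℝ) (hW : ∀ a b, |(w a b : ℝ)| ≤ W) (s : Q) (ρ : ℕ → Q) :
    MP w (consPlay s ρ) = MP w ρ := by
  have hW0 : 0 ≤ W := (abs_nonneg _).trans (hW s s)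
  unfold MP
  rw [← liminf_nat_add (fun n => (EL w (consPlay s ρ) n : ℝ) / n) 1]
  refine liminf_eq_of_tendsto_sub _ _ W (fun n => abs_EL_div_le w W hW _ _)
    (fun n => abs_EL_div_le w W hW _ _) ?_
  have e : ∀ n : ℕ, (EL w (consPlay s ρ) (n + 1) : ℝ) / ((n + 1 : ℕ) : ℝ) - (EL w ρ n : ℝ) / n
      = ((w s (ρ 0) : ℝ) - (EL w ρ n : ℝ) / n) / ((n : ℝ) + 1) := by
    intro n
    have h1 : EL w (consPlay s ρ) (n + 1) = w s (ρ 0) + EL w ρ n := by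
      unfold EL
      rw [Finset.sum_range_succ', add_comm]
      rfl
    rw [h1]
    push_cast
    rcases Nat.eq_zero_or_pos n with rfl | hn
    · simp [EL]
    have hn' : (0 : ℝ) < n := by exact_mod_cast hn
    field_simp
    ring
  refine squeeze_zero_norm (a := fun n : ℕ => 2 * W * (1 / ((n : ℝ) + 1))) ?_ ?_
  · intro n
    rw [e, Real.norm_eq_abs, abs_div, abs_of_pos (by positivity : (0 : ℝ) < (n : ℝ) + 1),
      mul_one_div]
    gcongr
    have h1 := abs_le.1 (hW s (ρ 0))
    have h2 := abs_le.1 (abs_EL_div_le w W hW ρ n)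
    rw [abs_le]
    constructor <;> linarith [h1.1, h1.2, h2.1, h2.2]
  · have := tendsto_one_div_add_atTop_nhds_zero_nat (𝕜 := ℝ)
    simpa using this.const_mul (2 * W)

lemma exists_bound [Fintype Q] (w : Q → Q → ℤ) : ∃ W : ℝ, ∀ a b, |(w a b : ℝ)| ≤ W := by
  obtain ⟨W, hW⟩ := (Set.finite_range fun p : Q × Q => |(w p.1 p.2 : ℝ)|).bddAbove
  exact ⟨W, fun a b => hW ⟨(a, b), rfl⟩⟩

lemma measurable_MP [Fintype Q] [MeasurableSpace Q] [MeasurableSingletonClass Q]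
    (w : Q → Q → ℤ) : Measurable (MP w) := by
  unfold MP
  refine Measurable.liminf fun n => ?_
  refine Measurable.div_const ?_ _
  unfold EL
  push_cast
  refine Finset.measurable_sum _ fun i _ => ?_
  have h : Measurable fun p : Q × Q => (w p.1 p.2 : ℝ) := measurable_of_finite _
  have h2 : Measurable fun ρ : ℕ → Q => (ρ i, ρ (i + 1)) :=
    (measurable_pi_apply i).prodMk (measurable_pi_apply (i + 1))
  exact h.comp h2

lemma integrable_MP [Fintype Q] [MeasurableSpace Q] [MeasurableSingletonClass Q]
    (w : Q → Q → ℤ) (μ : Measure (ℕ → Q)) [IsFiniteMeasure μ] : Integrable (MP w) μ := by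
  obtain ⟨W, hW⟩ := exists_bound w
  exact Integrable.of_bound (measurable_MP w).aestronglyMeasurable W
    (Eventually.of_forall fun ρ => abs_MP_le w W hW ρ)

/-- The set of achievable expectations. -/
def valSet [MeasurableSpace Q] (M : MDP Q) (w : Q → Q → ℤ) (q : Q) : Set ℝ :=
  {x | ∃ σ : Strategy M, ∃ μ : Measure (ℕ → Q),
    IsTrajMeasure M σ q μ ∧ x = ∫ ρ, MP w ρ ∂μ}

lemma bddAbove_valSet [Fintype Q] [MeasurableSpace Q] [MeasurableSingletonClass Q]
    (M : MDP Q) (w : Q → Q → ℤ) (q : Q) : BddAbove (valSet M w q) := by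
  obtain ⟨W, hW⟩ := exists_bound w
  refine ⟨W, ?_⟩
  rintro x ⟨σ, μ, ⟨hp, -⟩, rfl⟩
  have := integral_mono (integrable_MP w μ) (integrable_const W)
    (fun ρ => (abs_le.1 (abs_MP_le w W hW ρ)).2)
  simpa using this

/-- A default memoryless strategy. -/
noncomputable def defaultStrategy (M : MDP Q) : Strategy M where
  act _ q := PMF.pure (M.E_nonempty q).choose
  act_support h q _ q' hq' := by
    rw [PMF.support_pure, Set.mem_singleton_iff] at hq'
    rw [hq']
    exact (M.E_nonempty q).choose_spec

/-- The play driven by a table of random successors. -/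
def drive (q : Q) (ω : ℕ × Q → Q) : ℕ → Q
  | 0 => q
  | n + 1 => ω (n, drive q ω n)

lemma measurable_drive [Fintype Q] [MeasurableSpace Q] [MeasurableSingletonClass Q] (q : Q) :
    Measurable (drive q) := by
  refine measurable_pi_lambda _ fun n => ?_
  induction n with
  | zero => exact measurable_const
  | succ n ih =>
    have h : Measurable fun p : (ℕ × Q → Q) × Q => p.1 (n, p.2) :=
      measurable_from_prod_countable_left fun x => measurable_pi_apply (n, x)
    exact h.comp (measurable_id.prodMk ih)

lemma pathProb_default (M : MDP Q) (n : ℕ) (f : ℕ → Q) (h : List Q) :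
    pathProb M (defaultStrategy M) h (f 0) ((List.range n).map fun i => f (i + 1)) =
      ∏ i ∈ Finset.range n, M.step (defaultStrategy M) [] (f i) (f (i + 1)) := by
  induction n generalizing f h with
  | zero => simp [pathProb]
  | succ n ih =>
    rw [List.range_succ_eq_map, Finset.prod_range_succ', mul_comm]
    simp only [List.map_cons, List.map_map, pathProb]
    rw [show ((fun i => f (i + 1)) ∘ Nat.succ) = fun i => (fun j => f (j + 1)) (i + 1) from rfl,
      ih (fun j => f (j + 1))]
    rfl

lemma valSet_nonempty [Fintype Q] [MeasurableSpace Q] [MeasurableSingletonClass Q]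
    (M : MDP Q) (w : Q → Q → ℤ) (q : Q) : (valSet M w q).Nonempty := by
  set P : ℕ × Q → Measure Q := fun p => (M.step (defaultStrategy M) [] p.2).toMeasure with hP
  refine ⟨_, defaultStrategy M, (Measure.infinitePi P).map (drive q), ⟨?_, ?_⟩, rfl⟩
  · exact Measure.isProbabilityMeasure_map (measurable_drive q).aemeasurable
  intro n f
  have hm : MeasurableSet {ρ : ℕ → Q | ∀ i ≤ n, ρ i = f i} := by
    have : {ρ : ℕ → Q | ∀ i ≤ n, ρ i = f i} = ⋂ i ∈ Set.Iic n, (fun ρ => ρ i) ⁻¹' {f i} := by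
      ext; simp
    rw [this]
    exact MeasurableSet.biInter (Set.to_countable _) fun i _ =>
      measurable_pi_apply i (measurableSet_singleton _)
  rw [Measure.map_apply (measurable_drive q) hm]
  split_ifs with h0
  · subst h0
    have e : drive (f 0) ⁻¹' {ρ : ℕ → Q | ∀ i ≤ n, ρ i = f i} =
        Set.pi ((Finset.range n).image fun i => (i, f i) : Finset (ℕ × Q))
          (fun p => {f (p.1 + 1)}) := by
      ext ω
      simp only [Set.mem_preimage, Set.mem_ofPred_eq, Set.mem_pi, Finset.coe_image, Set.mem_image,
        Set.mem_singleton_iff, Finset.coe_range, Set.mem_Iio]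
      constructor
      · rintro h _ ⟨i, hi, rfl⟩
        have h1 := h (i + 1) hi
        rw [drive, h i hi.le] at h1
        exact h1
      · intro h i
        induction i with
        | zero => intro _; rfl
        | succ i ih =>
          intro hi
          rw [drive, ih (by omega)]
          exact h _ ⟨i, hi, rfl⟩
    rw [e, Measure.infinitePi_pi _ (fun _ _ => measurableSet_singleton _),
      Finset.prod_image (by intro a _ b _ h; exact (Prod.mk.inj h).1), pathProb_default]
    refine Finset.prod_congr rfl fun i _ => ?_
    exact PMF.toMeasure_apply_singleton _ _ (measurableSet_singleton _)
  · have e : drive q ⁻¹' {ρ : ℕ → Q | ∀ i ≤ n, ρ i = f i} = ∅ := by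
      ext ω
      simp only [Set.mem_preimage, Set.mem_ofPred_eq, Set.mem_empty_iff_false, iff_false]
      intro h
      exact h0 (h 0 (Nat.zero_le _)).symm
    rw [e, measure_empty]

/-- First play `p` at `s`, then continue with the strategy of the state reached. -/
noncomputable def glue (M : MDP Q) (s : Q) (p : PMF Q)
    (hp : s ∈ M.Q1 → ∀ q' ∈ p.support, M.E s q') (σ : Q → Strategy M) : Strategy M where
  act h q := match h with
    | [] => if q = s then p else (σ q).act [] q
    | _ :: r => (σ ((r ++ [q]).headD q)).act r q
  act_support h q hq q' hq' := by
    cases h with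
    | nil =>
      by_cases hs : q = s
      · subst hs
        simp only [if_true] at hq'
        exact hp hq q' hq'
      · simp only [if_neg hs] at hq'
        exact (σ q).act_support _ _ hq _ hq'
    | cons _ r => exact (σ _).act_support _ _ hq _ hq'

lemma pathProb_glue (M : MDP Q) (s : Q) (p : PMF Q)
    (hp : s ∈ M.Q1 → ∀ q' ∈ p.support, M.E s q') (σ : Q → Strategy M) (t : Q)
    (rest h : List Q) (q : Q) (ht : (h ++ [q]).head? = some t) :
    pathProb M (glue M s p hp σ) (s :: h) q rest = pathProb M (σ t) h q rest := by
  induction rest generalizing h q with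
  | nil => rfl
  | cons q' rest ih =>
    simp only [pathProb]
    rw [List.cons_append, ih (h ++ [q]) q' (by
      rw [List.head?_append, ht]; rfl)]
    congr 2
    unfold MDP.step
    split_ifs
    · have : (h ++ [q]).headD q = t := by
        rw [List.headD_eq_head?_getD, ht]; rfl
      simp only [glue, this]
    · rfl

lemma measurable_consPlay [MeasurableSpace Q] (s : Q) : Measurable (consPlay s) := by
  refine measurable_pi_lambda _ fun n => ?_
  cases n with
  | zero => exact measurable_const
  | succ n => exact measurable_pi_apply n

lemma glue_traj [Fintype Q] [MeasurableSpace Q] [MeasurableSingletonClass Q]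
    (M : MDP Q) (s : Q) (p : PMF Q)
    (hp : s ∈ M.Q1 → ∀ q' ∈ p.support, M.E s q') (hp' : s ∉ M.Q1 → p = M.δ s)
    (σ : Q → Strategy M) (μ : Q → Measure (ℕ → Q)) (hμ : ∀ t, IsTrajMeasure M (σ t) t (μ t)) :
    IsTrajMeasure M (glue M s p hp σ) s (∑ t, p t • (μ t).map (consPlay s)) := by
  have hprob : ∀ t, IsProbabilityMeasure (μ t) := fun t => (hμ t).1
  have hsum : ∑ t, p t = 1 := by rw [← tsum_fintype (L := .unconditional _)]; exact p.tsum_coe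
  constructor
  · constructor
    simp only [Measure.coe_finsetSum, Finset.sum_apply, Measure.smul_apply, smul_eq_mul]
    rw [← hsum]
    refine Finset.sum_congr rfl fun t _ => ?_
    rw [Measure.map_apply (measurable_consPlay s) MeasurableSet.univ]
    simp
  intro n f
  have hm : MeasurableSet {ρ : ℕ → Q | ∀ i ≤ n, ρ i = f i} := by
    have : {ρ : ℕ → Q | ∀ i ≤ n, ρ i = f i} = ⋂ i ∈ Set.Iic n, (fun ρ => ρ i) ⁻¹' {f i} := by
      ext; simp
    rw [this]
    exact MeasurableSet.biInter (Set.to_countable _) fun i _ =>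
      measurable_pi_apply i (measurableSet_singleton _)
  simp only [Measure.coe_finsetSum, Finset.sum_apply, Measure.smul_apply, smul_eq_mul,
    Measure.map_apply (measurable_consPlay s) hm]
  split_ifs with h0
  · subst h0
    cases n with
    | zero =>
      have e : consPlay (f 0) ⁻¹' {ρ : ℕ → Q | ∀ i ≤ 0, ρ i = f i} = Set.univ := by
        ext ρ
        simp [consPlay]
      simp only [e, measure_univ, mul_one, hsum]
      rfl
    | succ n =>
      have e : consPlay (f 0) ⁻¹' {ρ : ℕ → Q | ∀ i ≤ n + 1, ρ i = f i} =
          {ρ | ∀ i ≤ n, ρ i = (fun j => f (j + 1)) i} := by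
        ext ρ
        simp only [Set.mem_preimage, Set.mem_ofPred_eq]
        constructor
        · intro h i hi
          exact h (i + 1) (by omega)
        · intro h i hi
          cases i with
          | zero => rfl
          | succ i => exact h i (by omega)
      simp only [e, fun t => (hμ t).2 n (fun j => f (j + 1))]
      rw [Finset.sum_eq_single (f 1)]
      · rw [List.range_succ_eq_map]
        simp only [List.map_cons, List.map_map, pathProb, List.nil_append, zero_add, if_true]
        rw [pathProb_glue M (f 0) p hp σ (f 1) _ [] (f 1) rfl]
        congr 1
        unfold MDP.step
        split_ifs with hq
        · simp [glue]
        · rw [hp' hq]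
      · intro t _ ht
        rw [if_neg (by simpa using ht.symm), mul_zero]
      · simp
  · refine Finset.sum_eq_zero fun t _ => ?_
    have e : consPlay s ⁻¹' {ρ : ℕ → Q | ∀ i ≤ n, ρ i = f i} = ∅ := by
      ext ω
      simp only [Set.mem_preimage, Set.mem_ofPred_eq, Set.mem_empty_iff_false, iff_false]
      intro h
      exact h0 (h 0 (Nat.zero_le _)).symm
    rw [e, measure_empty, mul_zero]

/-- One-step optimality inequality. -/
lemma sum_le_ValMP [Fintype Q] [MeasurableSpace Q] [MeasurableSingletonClass Q]
    (M : MDP Q) (w : Q → Q → ℤ) (s : Q) (p : PMF Q)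
    (hp : s ∈ M.Q1 → ∀ q' ∈ p.support, M.E s q') (hp' : s ∉ M.Q1 → p = M.δ s) :
    ∑ t, (p t).toReal * ValMP M w t ≤ ValMP M w s := by
  have hsum : ∑ t, p t = 1 := by rw [← tsum_fintype (L := .unconditional _)]; exact p.tsum_coe
  have hsumR : ∑ t, (p t).toReal = 1 := by
    rw [← ENNReal.toReal_sum (fun t _ => p.apply_ne_top t), hsum, ENNReal.toReal_one]
  obtain ⟨W, hW⟩ := exists_bound w
  refine le_of_forall_pos_le_add fun ε hε => ?_
  have hex : ∀ t, ∃ σ : Strategy M, ∃ μ : Measure (ℕ → Q),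
      IsTrajMeasure M σ t μ ∧ ValMP M w t - ε < ∫ ρ, MP w ρ ∂μ := by
    intro t
    obtain ⟨x, ⟨σ, μ, hμ, rfl⟩, hx⟩ := exists_lt_of_lt_csSup (valSet_nonempty M w t)
      (show ValMP M w t - ε < sSup (valSet M w t) from sub_lt_self _ hε)
    exact ⟨σ, μ, hμ, hx⟩
  choose σ μ hμ hx using hex
  have hprob : ∀ t, IsProbabilityMeasure (μ t) := fun t => (hμ t).1
  have hle : ∫ ρ, MP w ρ ∂(∑ t, p t • (μ t).map (consPlay s)) ≤ ValMP M w s :=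
    le_csSup (bddAbove_valSet M w s) ⟨_, _, glue_traj M s p hp hp' σ μ hμ, rfl⟩
  have hint : ∀ t, ∫ ρ, MP w ρ ∂((μ t).map (consPlay s)) = ∫ ρ, MP w ρ ∂(μ t) := by
    intro t
    rw [integral_map (measurable_consPlay s).aemeasurable (measurable_MP w).aestronglyMeasurable]
    simp only [MP_consPlay w W hW]
  rw [integral_finsetSum_measure] at hle
  · simp only [integral_smul_measure, hint, smul_eq_mul] at hle
    have : ∑ t, (p t).toReal * (ValMP M w t - ε) ≤ ∑ t, (p t).toReal * ∫ ρ, MP w ρ ∂(μ t) :=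
      Finset.sum_le_sum fun t _ => mul_le_mul_of_nonneg_left (hx t).le ENNReal.toReal_nonneg
    simp only [mul_sub, Finset.sum_sub_distrib, ← Finset.sum_mul, hsumR, one_mul] at this
    linarith
  · intro t _
    have : IsProbabilityMeasure ((μ t).map (consPlay s)) :=
      Measure.isProbabilityMeasure_map (measurable_consPlay s).aemeasurable
    exact (integrable_MP w _).smul_measure (p.apply_ne_top t)

/-- In an MDP whose whole state space is an end-component, the expected
mean-payoff value is the same at every state. -/
theorem uniform_value [Fintype Q] [Nonempty Q]
    [MeasurableSpace Q] [MeasurableSingletonClass Q]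
    (M : MDP Q) (w : Q → Q → ℤ)
    (hEC : M.IsEndComponent Set.univ) :
    ∀ q q' : Q, ValMP M w q = ValMP M w q' := by
  obtain ⟨m, hm⟩ := Finite.exists_min (ValMP M w)
  have hstep : ∀ s t, M.E s t → ValMP M w s = ValMP M w m → ValMP M w t = ValMP M w m := by
    intro s t hst hs
    refine le_antisymm ?_ (hm t)
    by_cases h1 : s ∈ M.Q1
    · have h := sum_le_ValMP M w s (PMF.pure t) (fun _ q' hq' => by
        rw [PMF.support_pure, Set.mem_singleton_iff] at hq'
        rw [hq']
        exact hst) (fun h => absurd h1 h)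
      rw [Finset.sum_eq_single t (fun b _ hb => by simp [PMF.pure_apply, hb]) (by simp)] at h
      simpa [PMF.pure_apply, hs] using h
    · have h := sum_le_ValMP M w s (M.δ s) (fun h => absurd h h1) (fun _ => rfl)
      have hsum : ∑ t, M.δ s t = 1 := by
        rw [← tsum_fintype (L := .unconditional _)]; exact (M.δ s).tsum_coe
      have hsumR : ∑ t, (M.δ s t).toReal = 1 := by
        rw [← ENNReal.toReal_sum (fun t _ => (M.δ s).apply_ne_top t), hsum, ENNReal.toReal_one]
      by_contra hlt
      push Not at hlt
      have hpos : 0 < (M.δ s t).toReal :=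
        ENNReal.toReal_pos ((PMF.mem_support_iff _ _).1 ((M.δ_support s h1 t).2 hst))
          ((M.δ s).apply_ne_top t)
      have : ∑ t, (M.δ s t).toReal * ValMP M w m < ∑ t, (M.δ s t).toReal * ValMP M w t :=
        Finset.sum_lt_sum
          (fun b _ => mul_le_mul_of_nonneg_left (hm b) ENNReal.toReal_nonneg)
          ⟨t, Finset.mem_univ _, mul_lt_mul_of_pos_left hlt hpos⟩
      rw [← Finset.sum_mul, hsumR, one_mul] at this
      linarith
  have hall : ∀ q, ValMP M w q = ValMP M w m := by
    intro q
    have hr := hEC.2.2.2 m (Set.mem_univ _) q (Set.mem_univ _)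
    induction hr with
    | refl => rfl
    | tail _ hbc ih => exact hstep _ _ hbc.2.2 ih
  intro q q'
  rw [hall q, hall q']


end MPP
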